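/- arXiv:1504.00218 — 2 statements merged into one kernel-verified Lean document; each statement's English description precedes it below -/
import Mathlib

section
/- Every SIP subset A of ℕ (including ℕ itself) can be partitioned into two sets A₀ and A₁ (A = A₀ ∪ A₁, A₀ ∩ A₁ = ∅) such that neither A₀ nor A₁ contains a translate of an SIP set. Consequently, the family of subsets of ℕ that contain a translate of an SIP set is not a filterdual, i.e. it fails the Ramsey property. -/
/-- `IP A`: the set of all finite sums of distinct elements of `A ⊆ ℤ`
(sums over finite subsets `F ⊆ A`, with the empty sum equal to `0`). -/
def IP (A : Set ℤ) : Set ℤ :=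
  {t | ∃ F : Finset ℤ, ↑F ⊆ A ∧ t = ∑ x ∈ F, x}

/-- `SIP A = IP A - IP A`. -/
def SIP (A : Set ℤ) : Set ℤ :=
  {d | ∃ s ∈ IP A, ∃ t ∈ IP A, d = s - t}

/-- The positive part `S_+ = S ∩ ℕ` of a set of integers. -/
def posPart (S : Set ℤ) : Set ℤ := S ∩ {n : ℤ | 0 < n}

/-- `B` (a set of positive integers) is an SIP set: there is an infinite set
`A` of positive integers with `SIP(A)_+ ⊆ B`. -/
def IsSIPSet (B : Set ℤ) : Prop :=
  ∃ A : Set ℤ, A ⊆ {n : ℤ | 0 < n} ∧ A.Infinite ∧ posPart (SIP A) ⊆ B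

/-- `B` contains a translate of an SIP set: there are an infinite set `A` of
positive integers and `u ∈ ℤ` with `(u + SIP(A))_+ ⊆ B`. -/
def ContainsTranslateSIP (B : Set ℤ) : Prop :=
  ∃ A : Set ℤ, A ⊆ {n : ℤ | 0 < n} ∧ A.Infinite ∧
    ∃ u : ℤ, posPart ((fun t => u + t) '' SIP A) ⊆ B

/-- parity of the number of blocks of ones in the binary expansion -/
def blk (n : ℕ) : Bool :=
  if n = 0 then false else if n % 2 = 0 then blk (n / 2)
  else if n % 4 = 1 then !blk (n / 4) else blk (n / 2)
termination_by n
decreasing_by all_goals omega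

theorem blk_zero : blk 0 = false := by rw [blk]; simp

theorem blk_even (n : ℕ) : blk (2 * n) = blk n := by
  by_cases h : n = 0
  · subst h; rfl
  · rw [blk, if_neg (by omega), if_pos (by omega)]
    congr 1; omega

theorem blk_one (n : ℕ) : blk (4 * n + 1) = !blk n := by
  rw [blk, if_neg (by omega), if_neg (by omega), if_pos (by omega)]
  congr 2; omega

theorem blk_three (n : ℕ) : blk (4 * n + 3) = blk (2 * n + 1) := by
  rw [blk, if_neg (by omega), if_neg (by omega), if_neg (by omega)]
  congr 1; omega

theorem blk_pow (k n : ℕ) : blk (2 ^ k * n) = blk n := by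
  induction k with
  | zero => simp
  | succ k ih => rw [pow_succ', mul_assoc, blk_even, ih]

theorem blk_concat (x : ℕ) : ∀ m y : ℕ, x < 2 ^ m →
    blk (2 ^ (m + 1) * y + x) = Bool.xor (blk y) (blk x) := by
  induction x using Nat.strong_induction_on with
  | _ x ih =>
  intro m y hx
  by_cases h0 : x = 0
  · subst h0; simp [blk_pow, blk_zero]
  have hm : m ≠ 0 := by rintro rfl; simp at hx; omega
  obtain ⟨m, rfl⟩ := Nat.exists_eq_succ_of_ne_zero hm
  have hp : 2 ^ (m + 1) = 2 * 2 ^ m := pow_succ' _ _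
  rw [Nat.succ_eq_add_one] at *
  have hP : 2 ^ (m + 1 + 1) * y = 2 * (2 ^ (m + 1) * y) := by rw [pow_succ']; ring
  obtain ⟨v, hv | hv | hv⟩ : ∃ v, x = 2 * v ∨ x = 4 * v + 1 ∨ x = 4 * v + 3 := by
    by_cases h : x % 2 = 0
    · exact ⟨x / 2, by omega⟩
    · exact ⟨x / 4, by omega⟩
  · subst hv
    rw [hP, ← mul_add, blk_even, blk_even]
    exact ih v (by omega) m y (by omega)
  · subst hv
    by_cases hm : m = 0
    · subst hm
      have : v = 0 := by omega
      subst this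
      have := blk_one y
      have h1 := blk_one 0
      simp only [blk_zero, mul_zero, zero_add] at h1
      norm_num
      rw [this, h1]; simp
    · obtain ⟨m, rfl⟩ := Nat.exists_eq_succ_of_ne_zero hm
      rw [Nat.succ_eq_add_one] at *
      have hp : 2 ^ (m + 1) = 2 * 2 ^ m := pow_succ' _ _
      have e : 2 ^ (m + 1 + 1 + 1) * y + (4 * v + 1) = 4 * (2 ^ (m + 1) * y + v) + 1 := by ring
      rw [e, blk_one, blk_one, ih v (by omega) m y (by omega)]
      simp
  · subst hv
    have hm : m ≠ 0 := by rintro rfl; simp at hx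
    obtain ⟨m, rfl⟩ := Nat.exists_eq_succ_of_ne_zero hm
    rw [Nat.succ_eq_add_one] at *
    have e : 2 ^ (m + 1 + 1 + 1) * y + (4 * v + 3) = 4 * (2 ^ (m + 1) * y + v) + 3 := by ring
    rw [e, blk_three, blk_three, ← ih (2 * v + 1) (by omega) (m + 1) y (by omega)]
    congr 1; ring

theorem blk_ones (k : ℕ) : ∀ w, w + 1 = 2 ^ k → blk (2 * w + 1) = true := by
  induction k with
  | zero => intro w hw
            have : w = 0 := by simpa using hw
            subst this
            have h1 := blk_one 0
            simpa [blk_zero] using h1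
  | succ k ih =>
    intro w hw
    rw [pow_succ'] at hw
    obtain ⟨v, rfl⟩ : ∃ v, w = 2 * v + 1 := ⟨w / 2, by omega⟩
    rw [show 2 * (2 * v + 1) + 1 = 4 * v + 3 by ring, blk_three]
    exact ih v (by omega)

theorem blk_compl (y : ℕ) : ∀ k w : ℕ, w + y + 1 = 2 ^ k → 2 * y < 2 ^ k →
    blk (2 * w + 1) = !blk y := by
  induction y using Nat.strong_induction_on with
  | _ y ih =>
  intro k w hw hy
  by_cases h0 : y = 0
  · subst h0; rw [blk_ones k w (by omega), blk_zero]; rfl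
  have hk : k ≠ 0 := by rintro rfl; simp at hy; omega
  obtain ⟨k, rfl⟩ := Nat.exists_eq_succ_of_ne_zero hk
  rw [Nat.succ_eq_add_one] at *
  have hp : 2 ^ (k + 1) = 2 * 2 ^ k := pow_succ' _ _
  obtain ⟨v, hv | hv⟩ : ∃ v, y = 2 * v ∨ y = 2 * v + 1 := ⟨y / 2, by omega⟩
  · subst hv
    obtain ⟨w, rfl⟩ : ∃ w', w = 2 * w' + 1 := ⟨w / 2, by omega⟩
    rw [show 2 * (2 * w + 1) + 1 = 4 * w + 3 by ring, blk_three, blk_even]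
    exact ih v (by omega) k w (by omega) (by omega)
  · have hk : k ≠ 0 := by rintro rfl; simp at hy; omega
    obtain ⟨k, rfl⟩ := Nat.exists_eq_succ_of_ne_zero hk
    rw [Nat.succ_eq_add_one] at *
    have hp : 2 ^ (k + 1) = 2 * 2 ^ k := pow_succ' _ _
    obtain ⟨x, hx | hx⟩ : ∃ x, v = 2 * x ∨ v = 2 * x + 1 := ⟨v / 2, by omega⟩
    · subst hx; subst hv
      obtain ⟨w, rfl⟩ : ∃ w', w = 4 * w' + 2 := ⟨w / 4, by omega⟩
      rw [show 2 * (4 * w + 2) + 1 = 4 * (2 * w + 1) + 1 by ring, blk_one,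
        show 2 * (2 * x) + 1 = 4 * x + 1 by ring, blk_one,
        ih x (by omega) k w (by omega) (by omega)]
    · subst hx; subst hv
      obtain ⟨w, rfl⟩ : ∃ w', w = 4 * w' := ⟨w / 4, by omega⟩
      have := ih (2 * x + 1) (by omega) (k + 1) (2 * w) (by omega) (by omega)
      rw [show 2 * (2 * w) + 1 = 4 * w + 1 by ring, blk_one] at this
      rw [show 2 * (4 * w) + 1 = 4 * (2 * w) + 1 by ring, blk_one, blk_even, this,
        show 2 * (2 * x + 1) + 1 = 4 * x + 3 by ring, blk_three]

theorem blk_core (v l y L z N N' t : ℕ) (hv : v < 2 ^ N) (hl : N < l)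
    (hb : 2 ^ l * (2 * y + 1) < 2 ^ N') (hL : N' < L)
    (ht : t + 2 ^ l * (2 * y + 1) = v + 2 ^ L * (2 * z + 1)) :
    blk t = Bool.xor (blk v) (Bool.xor (blk z) (!blk y)) := by
  have hlN : l < N' := by
    refine (Nat.pow_lt_pow_iff_right (a := 2) (by norm_num)).1 (lt_of_le_of_lt ?_ hb)
    exact Nat.le_mul_of_pos_right _ (by omega)
  obtain ⟨k, rfl⟩ : ∃ k, L = l + (k + 1) := ⟨L - l - 1, by omega⟩
  have hk : 2 * y + 1 < 2 ^ k := by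
    have : 2 ^ l * (2 * y + 1) < 2 ^ l * 2 ^ k := by
      rw [← pow_add]
      exact lt_of_lt_of_le hb (Nat.pow_le_pow_right (by norm_num) (by omega))
    exact lt_of_mul_lt_mul_left this (by positivity)
  obtain ⟨w, hw⟩ : ∃ w, w + y + 1 = 2 ^ k := ⟨2 ^ k - y - 1, by omega⟩
  have hc := blk_compl y k w hw (by omega)
  have h2 := blk_concat (2 * w + 1) (k + 1) z (by rw [pow_succ']; omega)
  obtain ⟨j, rfl⟩ : ∃ j, l = N + 1 + j := ⟨l - (N + 1), by omega⟩
  have e : t = 2 ^ (N + 1) * (2 ^ j * (2 ^ (k + 1 + 1) * z + (2 * w + 1))) + v := by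
    have : 2 ^ (N + 1 + j + (k + 1)) * (2 * z + 1) =
      2 ^ (N + 1) * (2 ^ j * (2 ^ (k + 1 + 1) * z + (2 * w + 1)))
        + 2 ^ (N + 1 + j) * (2 * y + 1) := by
      have : 2 ^ (N + 1 + j + (k + 1)) = 2 ^ (N + 1 + j) * (2 * 2 ^ k) := by
        rw [pow_add _ (N + 1 + j), pow_succ' 2 k]
      rw [this, pow_succ' 2 (k + 1), pow_succ' 2 k, ← hw]; ring
    omega
  rw [e, blk_concat v N _ hv, blk_pow, h2, hc, Bool.xor_comm]

theorem sip_pick (A : Set ℤ) (hA : A.Infinite) (F : Finset ℤ) (N : ℕ) :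
    ∃ (a a' : ℤ) (l y : ℕ), a ∈ A ∧ a' ∈ A ∧ a ∉ F ∧ a' ∉ F ∧ a ≠ a' ∧ N < l ∧
      a = a' + ((2 ^ l * (2 * y + 1) : ℕ) : ℤ) := by
  have hi : (A \ (F : Set ℤ)).Infinite := hA.sdiff F.finite_toSet
  obtain ⟨a, ha, b, hb, hab, he⟩ := hi.exists_ne_map_eq_of_mapsTo
    (f := fun x : ℤ => ((x : ZMod (2 ^ (N + 1))))) (t := Set.univ) (fun _ _ => Set.mem_univ _)
    Set.finite_univ
  wlog hlt : b < a generalizing a b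
  · exact this b hb a ha hab.symm he.symm (by omega)
  have hd : ((2 ^ (N + 1) : ℕ) : ℤ) ∣ a - b :=
    (ZMod.intCast_eq_intCast_iff_dvd_sub b a _).1 he.symm
  obtain ⟨n, hn⟩ := Int.eq_ofNat_of_zero_le (show 0 ≤ a - b by omega)
  obtain ⟨l, m, ⟨y, rfl⟩, hm⟩ := Nat.exists_eq_two_pow_mul_odd (n := n) (by omega)
  refine ⟨a, b, l, y, ha.1, hb.1, by simpa using ha.2, by simpa using hb.2, hab, ?_, ?_⟩
  · rw [hn] at hd
    have hd : 2 ^ (N + 1) ∣ n := by exact_mod_cast hd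
    rw [hm] at hd
    have h3 : 2 ^ (N + 1) ∣ 2 ^ l := by
      refine Nat.Coprime.dvd_of_dvd_mul_right ?_ hd
      apply Nat.Coprime.pow_left
      simp
    exact (Nat.pow_dvd_pow_iff_le_right (by norm_num)).1 h3
  · rw [← hm]; omega

theorem sip_mem (A : Set ℤ) (a0 a1 b1 a2 b2 : ℤ) (h0 : a0 ∈ A) (h1 : a1 ∈ A) (h1' : b1 ∈ A)
    (h2 : a2 ∈ A) (h2' : b2 ∈ A) (e1 : a1 ≠ a0) (e2 : b1 ≠ a0) (e3 : a2 ≠ a0) (e4 : b2 ≠ a0)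
    (e5 : a2 ≠ b1) (e6 : b2 ≠ a1) :
    a0 + (a2 - b2) - (a1 - b1) ∈ SIP A := by
  refine ⟨_, ⟨{a0, a2, b1}, ?_, rfl⟩, _, ⟨{b2, a1}, ?_, rfl⟩, ?_⟩
  · intro x hx; simp at hx; rcases hx with rfl | rfl | rfl <;> assumption
  · intro x hx; simp at hx; rcases hx with rfl | rfl <;> assumption
  · rw [Finset.sum_insert (by simp; exact ⟨e3.symm, e2.symm⟩), Finset.sum_pair e5,
      Finset.sum_pair e6]
    ring

theorem not_translate (c : Bool) (S : Set ℤ) (hS : ∀ x ∈ S, blk x.toNat = c) :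
    ¬ ContainsTranslateSIP S := by
  rintro ⟨A, hpos, hA, u, hu⟩
  obtain ⟨a0, ha0, hlt⟩ : ∃ a ∈ A, 0 < u + a := by
    by_contra! h
    exact hA ((Set.finite_Icc 0 (-u)).subset fun x hx =>
      ⟨le_of_lt (hpos hx), by have := h x hx; omega⟩)
  obtain ⟨v, hv⟩ := Int.eq_ofNat_of_zero_le hlt.le
  have key : ∀ s ∈ SIP A, 0 < u + s → blk (u + s).toNat = c := fun s hs h =>
    hS _ (hu ⟨⟨s, hs, rfl⟩, h⟩)
  have kv : blk v = c := by
    have := key a0 ⟨a0, ⟨{a0}, by simpa using ha0, by simp⟩, 0, ⟨∅, by simp, by simp⟩, by simp⟩ hlt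
    rwa [hv] at this
  have kk : ∀ (a b a' b' : ℤ) (l y L z N N' : ℕ), a ∈ A → b ∈ A → a' ∈ A → b' ∈ A →
      a ≠ a0 → b ≠ a0 → a' ≠ a0 → b' ≠ a0 → a' ≠ b → b' ≠ a → v < 2 ^ N → N < l →
      2 ^ l * (2 * y + 1) < 2 ^ N' → N' < L → a = b + ((2 ^ l * (2 * y + 1) : ℕ) : ℤ) →
      a' = b' + ((2 ^ L * (2 * z + 1) : ℕ) : ℤ) → blk y ≠ blk z := by
    intro a b a' b' l y L z N N' ha hb ha' hb' n1 n2 n3 n4 n5 n6 hvN hl hB hL e e' heq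
    have hlt2 : 2 ^ l * (2 * y + 1) < 2 ^ L * (2 * z + 1) :=
      hB.trans (lt_of_lt_of_le (Nat.pow_lt_pow_right (by norm_num) hL)
        (Nat.le_mul_of_pos_right _ (by omega)))
    obtain ⟨t, ht⟩ : ∃ t, t + 2 ^ l * (2 * y + 1) = v + 2 ^ L * (2 * z + 1) :=
      ⟨v + 2 ^ L * (2 * z + 1) - 2 ^ l * (2 * y + 1), by omega⟩
    have hc := blk_core v l y L z N N' t hvN hl hB hL ht
    have hm := sip_mem A a0 a b a' b' ha0 ha hb ha' hb' n1 n2 n3 n4 n5 n6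
    generalize 2 ^ l * (2 * y + 1) = B at *
    generalize 2 ^ L * (2 * z + 1) = B' at *
    have hs : u + (a0 + (a' - b') - (a - b)) = t := by omega
    have := key _ hm (by omega)
    rw [hs, Int.toNat_natCast, hc, heq, kv] at this
    revert this
    cases c <;> cases blk z <;> simp
  have big : ∀ n : ℕ, n < 2 ^ n := fun n => Nat.lt_two_pow_self
  obtain ⟨a1, b1, l1, y1, A1, B1, nA1, nB1, ne1, hl1, E1⟩ := sip_pick A hA {a0} v
  obtain ⟨a2, b2, l2, y2, A2, B2, nA2, nB2, ne2, hl2, E2⟩ :=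
    sip_pick A hA {a0, a1, b1} (v + 2 ^ l1 * (2 * y1 + 1))
  obtain ⟨a3, b3, l3, y3, A3, B3, nA3, nB3, ne3, hl3, E3⟩ :=
    sip_pick A hA {a0, a1, b1, a2, b2} (2 ^ l1 * (2 * y1 + 1) + 2 ^ l2 * (2 * y2 + 1))
  simp only [Finset.mem_insert, Finset.mem_singleton, not_or] at nA1 nB1 nA2 nB2 nA3 nB3
  have k12 := kk a1 b1 a2 b2 l1 y1 l2 y2 v _ A1 B1 A2 B2 (by tauto) (by tauto) (by tauto)
    (by tauto) (by tauto) (by tauto) (big v) hl1 (big _) (by omega) E1 E2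
  have k13 := kk a1 b1 a3 b3 l1 y1 l3 y3 v _ A1 B1 A3 B3 (by tauto) (by tauto) (by tauto)
    (by tauto) (by tauto) (by tauto) (big v) hl1 (big _) (by omega) E1 E3
  have k23 := kk a2 b2 a3 b3 l2 y2 l3 y3 v _ A2 B2 A3 B3 (by tauto) (by tauto) (by tauto)
    (by tauto) (by tauto) (by tauto) (big v) (by omega) (big _) (by omega) E2 E3
  revert k12 k13 k23
  cases blk y1 <;> cases blk y2 <;> cases blk y3 <;> simp

/-- every SIP subset `A` of `ℕ` can be partitioned into two sets
neither of which contains a translate of an SIP set; consequently the family of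
subsets of `ℕ` containing a translate of an SIP set fails the Ramsey property
(is not a filterdual). -/
theorem sip_partition_no_translate :
    (∀ A : Set ℤ, A ⊆ {n : ℤ | 0 < n} → IsSIPSet A →
      ∃ A₀ A₁ : Set ℤ, A₀ ∪ A₁ = A ∧ A₀ ∩ A₁ = ∅ ∧
        ¬ ContainsTranslateSIP A₀ ∧ ¬ ContainsTranslateSIP A₁) ∧
    ¬ (∀ B₁ B₂ : Set ℤ, B₁ ⊆ {n : ℤ | 0 < n} → B₂ ⊆ {n : ℤ | 0 < n} →
        ContainsTranslateSIP (B₁ ∪ B₂) →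
        ContainsTranslateSIP B₁ ∨ ContainsTranslateSIP B₂) := by
  have part : ∀ A : Set ℤ, 
      ∃ A₀ A₁ : Set ℤ, A₀ ∪ A₁ = A ∧ A₀ ∩ A₁ = ∅ ∧
        ¬ ContainsTranslateSIP A₀ ∧ ¬ ContainsTranslateSIP A₁ := by
    intro A
    refine ⟨{x ∈ A | blk x.toNat = false}, {x ∈ A | blk x.toNat = true}, ?_, ?_,
      not_translate false _ fun x hx => hx.2, not_translate true _ fun x hx => hx.2⟩
    · ext x
      simp only [Set.mem_union, Set.mem_setOf_eq]
      cases blk x.toNat <;> simp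
    · ext x
      simp only [Set.mem_inter_iff, Set.mem_setOf_eq, Set.mem_empty_iff_false]
      cases blk x.toNat <;> simp
  refine ⟨fun A _ _ => part A, fun h => ?_⟩
  obtain ⟨B₁, B₂, hU, -, h1, h2⟩ := part {n : ℤ | 0 < n}
  have := h B₁ B₂ (hU ▸ Set.subset_union_left) (hU ▸ Set.subset_union_right) (by
    rw [hU]
    exact ⟨{n : ℤ | 0 < n}, subset_rfl, Set.Ioi_infinite 0, 0, fun x hx => hx.2⟩)
  tauto
end

section
/- Let (X,T) be a mild mixing dynamical system, let U, V ⊆ X be nonempty open sets, and let A ⊆ ℕ be a set containing a translate of an SIP set. Then N(U,V) ∩ A contains a translate of an SIP set. (Hence the family M generated by the hitting time sets of mild mixing systems is contained in the sharp dual of the family of translated SIP sets.) -/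
/-- The hitting time set `N(A,B) = {n ∈ ℕ : T^n(A) ∩ B ≠ ∅}` (as a set of
positive integers, viewed inside `ℤ`). -/
def hitting {X : Type*} [TopologicalSpace X] (T : X ≃ₜ X) (A B : Set X) : Set ℤ :=
  {n : ℤ | 0 < n ∧ ∃ x ∈ A, (⇑T)^[n.toNat] x ∈ B}

/-- `(X,T)` is mild mixing: for all nonempty open `U,V`, the set `N(U,V)` meets
every SIP subset of `ℕ`. -/
def MildMixing {X : Type*} [TopologicalSpace X] (T : X ≃ₜ X) : Prop :=
  ∀ U V : Set X, IsOpen U → IsOpen V → U.Nonempty → V.Nonempty →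
    ∀ A : Set ℤ, A ⊆ {n : ℤ | 0 < n} → IsSIPSet A → (hitting T U V ∩ A).Nonempty

namespace SIPAux

/-- signed sums of `c` over the block `[l, m)`. -/
def S (c : ℕ → ℤ) (l m : ℕ) (x : ℤ) : Prop :=
  ∃ e : ℕ → ℤ, (∀ i, e i = 0 ∨ e i = 1 ∨ e i = -1) ∧ x = ∑ i ∈ Finset.Ico l m, e i * c i

lemma S_zero (c : ℕ → ℤ) (l m : ℕ) : S c l m 0 := ⟨fun _ => 0, by simp, by simp⟩

lemma S_neg {c : ℕ → ℤ} {l m : ℕ} {x : ℤ} (h : S c l m x) : S c l m (-x) := by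
  obtain ⟨e, he, rfl⟩ := h
  refine ⟨fun i => - e i, fun i => ?_, by simp⟩
  have := he i
  simp only; omega

lemma S_add {c : ℕ → ℤ} {l m k : ℕ} {x y : ℤ} (hlm : l ≤ m) (hmk : m ≤ k)
    (hx : S c l m x) (hy : S c m k y) : S c l k (x + y) := by
  obtain ⟨e, he, rfl⟩ := hx
  obtain ⟨f, hf, rfl⟩ := hy
  refine ⟨fun i => if i < m then e i else f i, fun i => ?_, ?_⟩
  · by_cases h : i < m
    · simpa [h] using he i
    · simpa [h] using hf i
  · rw [← Finset.sum_Ico_consecutive _ hlm hmk]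
    congr 1
    · refine Finset.sum_congr rfl fun i hi => ?_
      simp [(Finset.mem_Ico.1 hi).2]
    · refine Finset.sum_congr rfl fun i hi => ?_
      simp [not_lt.2 (Finset.mem_Ico.1 hi).1]

lemma S_bound {c : ℕ → ℤ} (hpos : ∀ i, 0 < c i)
    (hc : ∀ k : ℕ, ∑ i ∈ Finset.range k, c i + k ≤ c k) (l : ℕ) (m : ℕ) (x : ℤ)
    (h : S c l m x) : x = 0 ∨ (l : ℤ) ≤ |x| := by
  obtain ⟨e, he, rfl⟩ := h
  have habs : ∀ k, |∑ i ∈ Finset.Ico l k, e i * c i| ≤ ∑ i ∈ Finset.range k, c i := by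
    intro k
    refine (Finset.abs_sum_le_sum_abs _ _).trans ?_
    refine (Finset.sum_le_sum (g := c) fun i _ => ?_).trans ?_
    · have := hpos i
      rcases he i with h | h | h <;> simp [h, abs_of_pos this, this.le]
    · refine Finset.sum_le_sum_of_subset_of_nonneg ?_ fun i _ _ => (hpos i).le
      intro i hi
      simpa using (Finset.mem_Ico.1 hi).2
  induction m with
  | zero => left; simp
  | succ k ih =>
    rcases lt_or_ge k l with hk | hk
    · left; rw [Finset.Ico_eq_empty_of_le (by omega)]; simp
    · rw [Finset.sum_Ico_succ_top hk]
      have h1 := hc k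
      have h2 := abs_le.1 (habs k)
      rcases he k with h | h | h
      · simpa [h] using ih
      · right; rw [h]; apply le_abs.2; left; omega
      · right; rw [h]; apply le_abs.2; right; omega

lemma S_SIP {c : ℕ → ℤ} (hinj : Function.Injective c) {l m : ℕ} {x : ℤ} (h : S c l m x) :
    x ∈ SIP (Set.range c) := by
  classical
  obtain ⟨e, he, rfl⟩ := h
  refine ⟨_, ⟨((Finset.Ico l m).filter (fun i => e i = 1)).image c, ?_, rfl⟩,
    _, ⟨((Finset.Ico l m).filter (fun i => e i = -1)).image c, ?_, rfl⟩, ?_⟩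
  · intro y; simp only [Finset.coe_image]; rintro ⟨i, _, rfl⟩; exact ⟨i, rfl⟩
  · intro y; simp only [Finset.coe_image]; rintro ⟨i, _, rfl⟩; exact ⟨i, rfl⟩
  · rw [Finset.sum_image hinj.injOn, Finset.sum_image hinj.injOn, Finset.sum_filter,
      Finset.sum_filter, ← Finset.sum_sub_distrib]
    refine Finset.sum_congr rfl fun i _ => ?_
    rcases he i with h | h | h <;> simp [h]

/-- every finite subset of the image comes from indices -/
lemma IP_image {c : ℕ → ℤ} (hinj : Function.Injective c) {I : Set ℕ} {x : ℤ}
    (h : x ∈ IP (c '' I)) : ∃ F : Finset ℕ, ↑F ⊆ I ∧ x = ∑ i ∈ F, c i := by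
  classical
  obtain ⟨F, hF, rfl⟩ := h
  obtain ⟨F', hF', rfl⟩ := Finset.subset_set_image_iff.1 hF
  exact ⟨F', hF', Finset.sum_image hinj.injOn⟩

lemma SIP_image {c : ℕ → ℤ} (hinj : Function.Injective c) {l : ℕ} {x : ℤ}
    (h : x ∈ SIP (c '' Set.Ici l)) : ∃ m, l ≤ m ∧ S c l m x := by
  classical
  obtain ⟨s, hs, t, ht, rfl⟩ := h
  obtain ⟨F, hF, rfl⟩ := IP_image hinj hs
  obtain ⟨G, hG, rfl⟩ := IP_image hinj ht
  obtain ⟨m, hm⟩ := (F ∪ G).exists_nat_subset_range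
  have key : ∀ H : Finset ℕ, ↑H ⊆ Set.Ici l → H ⊆ F ∪ G →
      ∑ i ∈ H, c i = ∑ i ∈ Finset.Ico l (max l m), (if i ∈ H then (1 : ℤ) else 0) * c i := by
    intro H hH hH2
    simp only [ite_mul, one_mul, zero_mul]
    rw [← Finset.sum_filter]
    refine Finset.sum_congr ?_ fun _ _ => rfl
    ext i
    simp only [Finset.mem_filter, Finset.mem_Ico]
    constructor
    · intro hi
      have h1 : l ≤ i := hH hi
      have h2 : i < m := by simpa using hm (hH2 hi)
      exact ⟨⟨h1, lt_max_of_lt_right h2⟩, hi⟩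
    · exact fun h => h.2
  refine ⟨max l m, le_max_left _ _,
    fun i => (if i ∈ F then (1 : ℤ) else 0) - (if i ∈ G then (1 : ℤ) else 0), fun i => ?_, ?_⟩
  · by_cases h1 : i ∈ F <;> by_cases h2 : i ∈ G <;> simp [h1, h2]
  · rw [key F hF Finset.subset_union_left, key G hG Finset.subset_union_right,
      ← Finset.sum_sub_distrib]
    exact Finset.sum_congr rfl fun i _ => by ring

lemma thin {B : Set ℤ} (hB : B ⊆ {n : ℤ | 0 < n}) (hinf : B.Infinite) :
    ∃ c : ℕ → ℤ, (∀ i, c i ∈ B) ∧ StrictMono c ∧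
      ∀ k : ℕ, ∑ i ∈ Finset.range k, c i + k ≤ c k := by
  have hbig : ∀ N : ℤ, ∃ b ∈ B, N < b := by
    intro N
    by_contra! hcon
    exact hinf ((Set.finite_Icc 0 N).subset fun b hb => ⟨(hB hb).le, hcon b hb⟩)
  obtain ⟨c, hc1, hc2⟩ := exists_seq_of_forall_finset_exists (· ∈ B)
    (fun x y : ℤ => 2 * x + 1 ≤ y) (by
      intro s hs
      obtain ⟨b, hb, hb2⟩ := hbig (∑ x ∈ s, (2 * x + 1))
      refine ⟨b, hb, fun x hx => ?_⟩
      have := Finset.single_le_sum (f := fun x : ℤ => 2 * x + 1)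
        (fun y hy => by have : 0 < y := hB (hs y hy)
                        omega) hx
      omega)
  have hpos : ∀ i, 0 < c i := fun i => hB (hc1 i)
  refine ⟨c, hc1, strictMono_nat_of_lt_succ fun n => ?_, fun k => ?_⟩
  · have := hc2 n (n+1) (by omega); have := hpos n; omega
  · induction k with
    | zero => simpa using (hpos 0).le
    | succ k ih =>
      rw [Finset.sum_range_succ]; push_cast
      have := hc2 k (k+1) (by omega); omega

lemma zpow_toNat {X : Type*} [TopologicalSpace X] (T : X ≃ₜ X) {n : ℤ} (hn : 0 < n) (x : X) :
    (⇑T)^[n.toNat] x = (T ^ n) x := by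
  obtain ⟨k, rfl⟩ := Int.eq_ofNat_of_zero_le hn.le
  simp only [Int.toNat_natCast, zpow_natCast]
  clear hn
  induction k generalizing x with
  | zero => rfl
  | succ k ih => rw [Function.iterate_succ_apply, ih, pow_succ]; rfl

lemma zpow_add_apply {X : Type*} [TopologicalSpace X] (T : X ≃ₜ X) (a b : ℤ) (x : X) :
    (T ^ (a + b)) x = (T ^ a) ((T ^ b) x) := by
  rw [zpow_add]; rfl

lemma step {X : Type*} [TopologicalSpace X] (T : X ≃ₜ X) (hmm : MildMixing T)
    {c : ℕ → ℤ} (hpos : ∀ i, 0 < c i) (hinj : Function.Injective c)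
    (hc : ∀ k : ℕ, ∑ i ∈ Finset.range k, c i + k ≤ c k)
    (U V : Set X) (hU : IsOpen U) (hV : IsOpen V) (hUne : U.Nonempty) (hVne : V.Nonempty)
    (l : ℕ) (N : ℤ) :
    ∃ b : ℤ, ∃ m : ℕ, N < b ∧ 0 < b ∧ l ≤ m ∧ S c l m b ∧ (U ∩ (T ^ b) ⁻¹' V).Nonempty := by
  set l' := max l (N.toNat + 1) with hl'
  obtain ⟨b, ⟨hb0, x, hx, hxV⟩, hb1, hb2⟩ := hmm U V hU hV hUne hVne
    (posPart (SIP (c '' Set.Ici l'))) (fun y hy => hy.2)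
    ⟨c '' Set.Ici l', by rintro _ ⟨i, _, rfl⟩; exact hpos i,
      (Set.Ici_infinite l').image hinj.injOn, subset_rfl⟩
  obtain ⟨m, hm, hS⟩ := SIP_image hinj hb1
  have hbd := S_bound hpos hc _ _ _ hS
  rw [abs_of_pos hb0] at hbd
  refine ⟨b, m, by omega, hb0, by omega, ?_, x, hx, ?_⟩
  · simpa using S_add (le_max_left _ _) hm (S_zero c l l') hS
  · rw [zpow_toNat T hb0] at hxV; exact hxV

end SIPAux

/-- if `(X,T)` is mild mixing, `U, V ⊆ X` are nonempty open sets
and `A ⊆ ℕ` contains a translate of an SIP set, then `N(U,V) ∩ A` contains a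
translate of an SIP set. -/
theorem hitting_inter_translate_sip {X : Type*} [MetricSpace X] [CompactSpace X]
    (T : X ≃ₜ X) (hmm : MildMixing T)
    (U V : Set X) (hU : IsOpen U) (hV : IsOpen V)
    (hUne : U.Nonempty) (hVne : V.Nonempty)
    (A : Set ℤ) (hA : A ⊆ {n : ℤ | 0 < n}) (hAtr : ContainsTranslateSIP A) :
    ContainsTranslateSIP (hitting T U V ∩ A) := by
  classical
  obtain ⟨B, hB, hBinf, u, hu⟩ := hAtr
  obtain ⟨c, hcB, hcm, hc⟩ := SIPAux.thin hB hBinf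
  have hpos : ∀ i, 0 < c i := fun i => hB (hcB i)
  have hinj := hcm.injective
  have hcont : ∀ n : ℤ, Continuous (T ^ n) := fun n => (T ^ n).continuous
  -- the translate
  obtain ⟨s0, l0, -, -, -, hs0, hne0⟩ := SIPAux.step T hmm hpos hinj hc U ((T ^ u) ⁻¹' V) hU
    (hV.preimage (hcont u)) hUne (by
      obtain ⟨y, hy⟩ := hVne
      exact ⟨(T ^ u).symm y, by simpa using hy⟩) 0 0
  set W : Set X := U ∩ (T ^ s0) ⁻¹' ((T ^ u) ⁻¹' V) with hW
  have hWo : IsOpen W := hU.inter ((hV.preimage (hcont u)).preimage (hcont s0))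
  -- recursion
  let St := {p : Set X × ℕ × ℤ // IsOpen p.1 ∧ p.1.Nonempty ∧ 0 ≤ p.2.2}
  have hstep : ∀ p : St, ∃ q : St, p.1.2.2 < q.1.2.2 ∧ p.1.2.1 ≤ q.1.2.1 ∧
      SIPAux.S c p.1.2.1 q.1.2.1 q.1.2.2 ∧ q.1.1 ⊆ p.1.1 ∩ (T ^ q.1.2.2) ⁻¹' p.1.1 := by
    rintro ⟨⟨P, l, b⟩, hPo, hPne, hb⟩
    obtain ⟨b', m, h1, h2, h3, h4, h5⟩ :=
      SIPAux.step T hmm hpos hinj hc P P hPo hPo hPne hPne l b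
    exact ⟨⟨⟨P ∩ (T ^ b') ⁻¹' P, m, b'⟩, hPo.inter (hPo.preimage (hcont b')), h5, h2.le⟩,
      h1, h3, h4, subset_rfl⟩
  choose next hn1 hn2 hn3 hn4 using hstep
  let seq : ℕ → St := fun n => next^[n] ⟨⟨W, l0, 0⟩, hWo, hne0, le_rfl⟩
  have hseq : ∀ n, seq (n + 1) = next (seq n) := fun n => Function.iterate_succ_apply' _ _ _
  let Wn : ℕ → Set X := fun n => (seq n).1.1
  let l : ℕ → ℕ := fun n => (seq n).1.2.1
  let b : ℕ → ℤ := fun n => (seq (n + 1)).1.2.2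
  have hb : StrictMono b := strictMono_nat_of_lt_succ fun n => by
    have := hn1 (seq (n + 1)); rw [← hseq] at this; exact this
  have hbpos : ∀ n, 0 < b n := fun n => by
    have := hn1 (seq n); rw [← hseq] at this; exact (seq n).2.2.2.trans_lt this
  have hl : ∀ n, l n ≤ l (n + 1) := fun n => by
    have := hn2 (seq n); rw [← hseq] at this; exact this
  have hS : ∀ n, SIPAux.S c (l n) (l (n + 1)) (b n) := fun n => by
    have := hn3 (seq n); rw [← hseq] at this; exact this
  have hWn : ∀ n, Wn (n + 1) ⊆ Wn n ∩ (T ^ (b n)) ⁻¹' Wn n := fun n => by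
    have := hn4 (seq n); rw [← hseq] at this; exact this
  have hret : ∀ (F : Finset ℕ) (n : ℕ) (x : X), x ∈ Wn n →
      (T ^ (∑ i ∈ Finset.range n, if i ∈ F then b i else 0)) x ∈ W := by
    intro F n
    induction n with
    | zero => intro x hx; change x ∈ W at hx; simpa using hx
    | succ n ih =>
      intro x hx
      have h := hWn n hx
      rw [Finset.sum_range_succ]
      by_cases hF : n ∈ F
      · rw [if_pos hF, SIPAux.zpow_add_apply]; exact ih _ h.2
      · rw [if_neg hF, add_zero]; exact ih _ h.1
  have hsum : ∀ (F G : Finset ℕ) (n : ℕ), SIPAux.S c 0 (l n)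
      (s0 + ∑ i ∈ Finset.range n, ((if i ∈ F then b i else 0) - (if i ∈ G then b i else 0))) := by
    intro F G n
    induction n with
    | zero => change SIPAux.S c 0 l0 _; simpa using hs0
    | succ n ih =>
      rw [Finset.sum_range_succ, ← add_assoc]
      refine SIPAux.S_add (Nat.zero_le _) (hl n) ih ?_
      by_cases hF : n ∈ F <;> by_cases hG : n ∈ G <;>
        simp [hF, hG, hS n, SIPAux.S_zero, SIPAux.S_neg (hS n)]
  have hrange : ∀ (F : Finset ℕ) (n : ℕ), F ⊆ Finset.range n →
      ∑ i ∈ F, b i = ∑ i ∈ Finset.range n, if i ∈ F then b i else 0 := by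
    intro F n hF
    rw [← Finset.sum_filter, Finset.filter_mem_eq_inter, Finset.inter_eq_right.2 hF]
  refine ⟨b '' Set.univ, by rintro _ ⟨i, _, rfl⟩; exact hbpos i,
    Set.infinite_univ.image hb.injective.injOn, u + s0, ?_⟩
  rintro _ ⟨⟨_, ⟨s, hs, t, ht, rfl⟩, rfl⟩, hp⟩
  obtain ⟨F, -, rfl⟩ := SIPAux.IP_image hb.injective hs
  obtain ⟨G, -, rfl⟩ := SIPAux.IP_image hb.injective ht
  obtain ⟨n, hn⟩ := (F ∪ G).exists_nat_subset_range
  rw [hrange F n (Finset.subset_union_left.trans hn),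
    hrange G n (Finset.subset_union_right.trans hn)] at *
  simp only [Set.mem_ofPred_eq] at hp
  refine ⟨⟨hp, ?_⟩, ?_⟩
  · obtain ⟨x, hx⟩ := (seq n).2.2.1
    have h1 := hret F n x hx
    have h2 := hret G n x hx
    refine ⟨_, h2.1, ?_⟩
    rw [SIPAux.zpow_toNat T hp, ← SIPAux.zpow_add_apply]
    have h3 := h1.2
    simp only [Set.mem_preimage, ← SIPAux.zpow_add_apply] at h3
    convert h3 using 3
    ring
  · refine hu ⟨⟨s0 + ∑ i ∈ Finset.range n, ((if i ∈ F then b i else 0) - (if i ∈ G then b i else 0)),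
      ?_, ?_⟩, hp⟩
    · obtain ⟨s, ⟨F', hF', rfl⟩, t, ⟨G', hG', rfl⟩, h⟩ := SIPAux.S_SIP hinj (hsum F G n)
      have hr : Set.range c ⊆ B := by rintro _ ⟨i, rfl⟩; exact hcB i
      exact ⟨_, ⟨F', hF'.trans hr, rfl⟩, _, ⟨G', hG'.trans hr, rfl⟩, h⟩
    · simp only [Finset.sum_sub_distrib]; ring
end
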